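/- Let p be a fixed prime and q ∈ (0,1) fixed. Then P_q(n) ∼ (1/√p)·(p/(2πq(1−q)))^{(p−1)/2}·n^{−(p−1)/2} as n → ∞ over composite integers n whose smallest prime divisor is p; i.e., for every ε > 0 there exists N such that for every composite n > N with smallest prime divisor equal to p, |P_q(n)·√p·(2πq(1−q)/p)^{(p−1)/2}·n^{(p−1)/2} − 1| < ε. -/

import Mathlib

open Finset

/-- The binomial probability mass function. -/
noncomputable def phi (q : ℝ) (k n : ℕ) : ℝ :=
  (n.choose k : ℝ) * q ^ k * (1 - q) ^ (n - k)

/-- The Bernoulli(q) probability weight of an outcome `c : Fin n → Bool`. -/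
noncomputable def bernWeight (q : ℝ) (n : ℕ) (c : Fin n → Bool) : ℝ :=
  q ^ (Finset.univ.filter (fun j => c j = true)).card *
    (1 - q) ^ (n - (Finset.univ.filter (fun j => c j = true)).card)

/-- Singularity probability of an `n × n` circulant Bernoulli(q) matrix (0/1 entries). -/
noncomputable def Pq (q : ℝ) (n : ℕ) : ℝ :=
  ∑ c : Fin n → Bool,
    if (Matrix.of fun i j : Fin n => (if c (j - i) then (1 : ℚ) else 0)).det = 0 then
      bernWeight q n c
    else 0
open Finset

open MeasureTheory Filter Topology in
lemma phi_nonneg' {q : ℝ} (hq0 : 0 < q) (hq1 : q < 1) (k m : ℕ) : 0 ≤ phi q k m := by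
  unfold phi
  have : 0 < 1 - q := by linarith
  positivity

lemma phi_sum_one (q : ℝ) (m : ℕ) : ∑ k ∈ range (m+1), phi q k m = 1 := by
  have := add_pow q (1 - q) m
  rw [add_sub_cancel, one_pow] at this
  rw [this]
  refine Finset.sum_congr rfl fun k _ => ?_
  unfold phi; ring

noncomputable def chi (q θ : ℝ) : ℂ := (1 - q) + q * Complex.exp (θ * Complex.I)

lemma chi_pow (q θ : ℝ) (m : ℕ) :
    chi q θ ^ m = ∑ k ∈ range (m+1), (phi q k m : ℂ) * Complex.exp (k * θ * Complex.I) := by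
  unfold chi
  rw [add_comm, add_pow]
  refine Finset.sum_congr rfl fun k _ => ?_
  unfold phi
  push_cast
  rw [mul_pow, ← Complex.exp_nat_mul]
  ring_nf

lemma chi_norm_le {q : ℝ} (hq0 : 0 < q) (hq1 : q < 1) {θ : ℝ} (hθ : |θ| ≤ Real.pi) :
    ‖chi q θ‖ ≤ Real.exp (-(2 * (q * (1-q)) / Real.pi^2 * θ^2)) := by
  have h1 : ‖chi q θ‖ ^ 2 = 1 - 2 * (q * (1-q)) * (1 - Real.cos θ) := by
    rw [← Complex.normSq_eq_norm_sq, Complex.normSq_apply]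
    unfold chi
    simp [Complex.exp_ofReal_mul_I_re, Complex.exp_ofReal_mul_I_im]
    have := Real.sin_sq_add_cos_sq θ
    linear_combination q^2 * this
  have h2 := Real.cos_le_one_sub_mul_cos_sq hθ
  have hv : 0 < q * (1-q) := mul_pos hq0 (by linarith)
  have h3 : ‖chi q θ‖ ^ 2 ≤ Real.exp (-(2 * (q * (1-q)) / Real.pi^2 * θ^2)) ^ 2 := by
    rw [h1, ← Real.exp_nat_mul]
    have h4 := Real.add_one_le_exp (-(2 * (q * (1-q)) * (1 - Real.cos θ)))
    have h5 : -(2 * (q * (1-q)) * (1 - Real.cos θ)) ≤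
      ((2:ℕ):ℝ) * -(2 * (q * (1-q)) / Real.pi^2 * θ^2) := by
      have h6 := mul_le_mul_of_nonneg_left h2 hv.le
      push_cast
      have : 2 * (q * (1 - q)) / Real.pi ^ 2 * θ ^ 2 = q * (1-q) * (2 / Real.pi^2 * θ^2) := by ring
      rw [this]
      nlinarith
    have := Real.exp_le_exp.mpr h5
    linarith
  exact (pow_le_pow_iff_left₀ (norm_nonneg _) (Real.exp_pos _).le two_ne_zero).mp h3

lemma integral_exp_int (n : ℤ) :
    ∫ θ in (-Real.pi)..Real.pi, Complex.exp (n * θ * Complex.I) =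
      if n = 0 then (2 * Real.pi : ℂ) else 0 := by
  split_ifs with h
  · subst h; simp; ring
  · have hc : (n : ℂ) * Complex.I ≠ 0 := by simp [h]
    have := integral_exp_mul_complex (a := -Real.pi) (b := Real.pi) hc
    have h2 : ∀ θ : ℝ, (n * θ * Complex.I : ℂ) = n * Complex.I * θ := fun θ => by ring
    simp_rw [h2]
    rw [this, div_eq_zero_iff, sub_eq_zero]
    left
    rw [Complex.exp_eq_exp_iff_exists_int]
    exact ⟨n, by push_cast; ring⟩

lemma phi_fourier (q : ℝ) (k m : ℕ) :
    (2 * Real.pi * phi q k m : ℂ) = ∫ θ in (-Real.pi)..Real.pi,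
      chi q θ ^ m * Complex.exp (-(k * θ * Complex.I)) := by
  have : ∀ θ : ℝ, chi q θ ^ m * Complex.exp (-(k * θ * Complex.I)) =
      ∑ j ∈ range (m+1), (phi q j m : ℂ) * Complex.exp (((j:ℤ) - (k:ℤ) : ℤ) * θ * Complex.I) := by
    intro θ
    rw [chi_pow, Finset.sum_mul]
    refine Finset.sum_congr rfl fun j _ => ?_
    rw [mul_assoc, ← Complex.exp_add]
    push_cast; ring_nf
  simp_rw [this]
  rw [intervalIntegral.integral_finsetSum]
  · simp_rw [intervalIntegral.integral_const_mul, integral_exp_int]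
    simp only [sub_eq_zero, Nat.cast_inj, mul_ite, mul_zero]
    rw [Finset.sum_ite_eq']
    split_ifs with h
    · ring
    · have : m < k := by simpa using h
      simp [phi, Nat.choose_eq_zero_of_lt this]
  · intro j _
    apply Continuous.intervalIntegrable
    fun_prop

noncomputable def fm (q : ℝ) (m : ℕ) (t : ℝ) : ℂ :=
  Complex.exp (-(t * q * √m * Complex.I)) * chi q (t / √m) ^ m

lemma fm_eq_sum (q : ℝ) {m : ℕ} (hm : 0 < m) (t : ℝ) :
    fm q m t = ∑ k ∈ range (m+1), (phi q k m : ℂ) *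
      Complex.exp (Complex.I * ((k - m * q) / √m : ℝ) * t) := by
  unfold fm
  rw [chi_pow, Finset.mul_sum]
  refine Finset.sum_congr rfl fun j _ => ?_
  rw [mul_left_comm, ← Complex.exp_add]
  congr 2
  have h : (√(m:ℝ) : ℂ) ≠ 0 := by
    have : (√(m:ℝ)) ≠ 0 := by positivity
    exact_mod_cast this
  have h2 : (√(m:ℝ) : ℂ) * √(m:ℝ) = m := by
    rw [← Complex.ofReal_mul, Real.mul_self_sqrt (by positivity)]; simp
  push_cast
  field_simp
  rw [pow_two, h2]
  ring

lemma fm_norm_le {q : ℝ} (hq0 : 0 < q) (hq1 : q < 1) {m : ℕ} (hm : 0 < m) {t : ℝ}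
    (ht : |t| ≤ Real.pi * √m) :
    ‖fm q m t‖ ≤ Real.exp (-(2 * (q * (1-q)) / Real.pi^2 * t^2)) := by
  have hs : 0 < √(m:ℝ) := by positivity
  unfold fm
  rw [norm_mul, norm_pow]
  have : ‖Complex.exp (-(t * q * √m * Complex.I))‖ = 1 := by
    have := Complex.norm_exp_ofReal_mul_I (-(t*q*√m))
    push_cast at this
    rw [← this]; ring_nf
  rw [this, one_mul]
  have h1 := chi_norm_le hq0 hq1 (θ := t / √m) (by rw [abs_div, abs_of_pos hs]; exact (div_le_iff₀ hs).mpr ht)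
  refine (pow_le_pow_left₀ (norm_nonneg _) h1 m).trans_eq ?_
  rw [← Real.exp_nat_mul]
  congr 1
  rw [div_pow, Real.sq_sqrt (by positivity)]
  field_simp

lemma fm_norm_le_one {q : ℝ} (hq0 : 0 < q) (hq1 : q < 1) {m : ℕ} (hm : 0 < m) (t : ℝ) :
    ‖fm q m t‖ ≤ 1 := by
  rw [fm_eq_sum q hm]
  refine (norm_sum_le _ _).trans ?_
  rw [← phi_sum_one q m]
  refine Finset.sum_le_sum fun k _ => ?_
  rw [norm_mul]
  have := Complex.norm_exp_ofReal_mul_I (((k - m * q) / √m : ℝ) * t)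
  rw [show Complex.I * ((k - m * q) / √m : ℝ) * t = ((((k - m * q) / √m : ℝ) * t : ℝ):ℂ) * Complex.I by push_cast; ring, this]
  simp [abs_of_nonneg (phi_nonneg' hq0 hq1 k m)]

open Filter Topology in
lemma fm_tendsto {q : ℝ} (hq0 : 0 < q) (hq1 : q < 1) (t : ℝ) :
    Tendsto (fun m => fm q m t) atTop (𝓝 (Complex.exp (-((q * (1-q) / 2 : ℝ) : ℂ) * t ^ 2))) := by
  set s : ℕ → ℝ := fun m => t / √m with hs
  set R : ℂ → ℂ := fun z => Complex.exp z - ∑ j ∈ range 3, z ^ j / j.factorial with hR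
  set a : ℕ → ℂ := fun m => -(q * s m * Complex.I) with ha
  set b : ℕ → ℂ := fun m => (1 - q) * s m * Complex.I with hb
  set g : ℕ → ℂ := fun m => (1 - q) * Complex.exp (a m) + q * Complex.exp (b m) - 1 with hg
  have h1 : ∀ᶠ m in atTop, (1 + g m) ^ m = fm q m t := by
    filter_upwards [eventually_gt_atTop 0] with m hm
    have hpos : 0 < √(m:ℝ) := by positivity
    have h2 : (√(m:ℝ) : ℂ) * √(m:ℝ) = m := by
      rw [← Complex.ofReal_mul, Real.mul_self_sqrt (by positivity)]; simp
    have h0 : (√(m:ℝ) : ℂ) ≠ 0 := by exact_mod_cast hpos.ne'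
    have : Complex.exp (-(t * q * √m * Complex.I)) = Complex.exp (a m) ^ m := by
      rw [← Complex.exp_nat_mul]
      congr 1
      simp only [ha, hs]
      rw [← h2]; push_cast; field_simp
    unfold fm
    rw [this, ← mul_pow]
    congr 1
    have h3 : Complex.exp (b m) = Complex.exp (a m) * Complex.exp (s m * Complex.I) := by
      rw [← Complex.exp_add]; congr 1; simp only [ha, hb]; ring
    simp only [hg, h3, chi]
    ring
  refine Tendsto.congr' h1 ?_
  apply Complex.tendsto_one_add_pow_exp_of_tendsto
  rw [tendsto_iff_norm_sub_tendsto_zero]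
  have h4 : Tendsto (fun m : ℕ => |t|^3 * Real.exp |t| * (1 / √(m:ℝ))) atTop (𝓝 0) := by
    rw [← mul_zero (|t|^3 * Real.exp |t|)]
    apply Tendsto.const_mul
    simp only [one_div]
    exact tendsto_inv_atTop_zero.comp (Real.tendsto_sqrt_atTop.comp tendsto_natCast_atTop_atTop)
  refine squeeze_zero' (Eventually.of_forall fun m => norm_nonneg _) ?_ h4
  filter_upwards [eventually_gt_atTop 0] with m hm
  have hpos : 0 < √(m:ℝ) := by positivity
  have hm1 : 1 ≤ √(m:ℝ) := by
    rw [Real.one_le_sqrt]; exact_mod_cast hm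
  have h2 : (√(m:ℝ) : ℂ) * √(m:ℝ) = m := by
    rw [← Complex.ofReal_mul, Real.mul_self_sqrt (by positivity)]; simp
  have h0 : (√(m:ℝ) : ℂ) ≠ 0 := by exact_mod_cast hpos.ne'
  have hst : (m:ℂ) * (s m)^2 = t^2 := by
    simp only [hs]; rw [← h2]; push_cast; field_simp
  have key : m * g m - (-((q * (1-q) / 2 : ℝ) : ℂ) * t ^ 2) = m * ((1 - q) * R (a m) + q * R (b m)) := by
    simp only [hR, Finset.sum_range_succ, Finset.sum_range_zero, hg, ha, hb]
    rw [← hst]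
    simp
    ring_nf
    simp
    ring
  rw [key]
  have hR3 : ∀ c : ℝ, |c| ≤ 1 → ∀ z : ℂ, ‖z‖ = |c| * |s m| → ‖R z‖ ≤ |s m|^3 * Real.exp |t| := by
    intro c hc z hz
    have hz' : ‖z‖ ≤ |s m| := by
      rw [hz]; exact mul_le_of_le_one_left (abs_nonneg _) hc
    refine (Complex.norm_exp_sub_sum_le_norm_mul_exp z 3).trans ?_
    have : |s m| ≤ |t| := by
      simp only [hs, abs_div, abs_of_pos hpos]
      exact div_le_self (abs_nonneg _) hm1
    gcongr
    exact hz'.trans this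
  have hA := hR3 q (by rw [abs_of_pos hq0]; exact hq1.le) (a m) (by simp [ha])
  have hB := hR3 (1-q) (by rw [abs_of_pos (by linarith)]; linarith) (b m) (by
    simp only [hb, norm_mul, Complex.norm_I, mul_one, Complex.norm_real, Real.norm_eq_abs]
    rw [← Complex.ofReal_one, ← Complex.ofReal_sub, Complex.norm_real, Real.norm_eq_abs])
  have h1q : ‖(1 - q : ℂ)‖ = 1 - q := by
    rw [← Complex.ofReal_one, ← Complex.ofReal_sub, Complex.norm_real, Real.norm_eq_abs, abs_of_pos (by linarith)]
  have hqn : ‖(q : ℂ)‖ = q := by rw [Complex.norm_real, Real.norm_eq_abs, abs_of_pos hq0]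
  calc ‖(m:ℂ) * ((1 - q) * R (a m) + q * R (b m))‖
      ≤ m * ((1-q) * (|s m|^3 * Real.exp |t|) + q * (|s m|^3 * Real.exp |t|)) := by
        rw [norm_mul, Complex.norm_natCast]
        gcongr
        refine (norm_add_le _ _).trans ?_
        rw [norm_mul, norm_mul, h1q, hqn]
        have : 0 < 1 - q := by linarith
        gcongr
    _ = |t|^3 * Real.exp |t| * (1 / √(m:ℝ)) := by
        simp only [hs, abs_div, abs_of_pos hpos]
        have : (m:ℝ) = √m * √m := by rw [Real.mul_self_sqrt (by positivity)]
        field_simp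
        rw [pow_two, ← this]; ring

lemma gauss_ft {V : ℝ} (hV : 0 < V) (x : ℝ) :
    ∫ t : ℝ, Complex.exp (Complex.I * x * t) * Complex.exp (-((V/2:ℝ):ℂ) * t^2) =
      ((√(2 * Real.pi / V) * Real.exp (-x^2 / (2*V)) : ℝ) : ℂ) := by
  rw [fourierIntegral_gaussian (by rw [Complex.ofReal_re]; positivity)]
  push_cast
  congr 1
  · rw [Real.sqrt_eq_rpow, Complex.ofReal_cpow (by positivity)]
    push_cast
    congr 1
    field_simp
  · congr 1
    push_cast
    field_simp
    norm_num

open Finset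

lemma fm_continuous (q : ℝ) (m : ℕ) : Continuous (fm q m) := by
  unfold fm chi
  fun_prop

noncomputable def Af (q : ℝ) (m : ℕ) : ℝ → ℂ :=
  (Set.Ioc (-(Real.pi * √m)) (Real.pi * √m)).indicator (fm q m)

open MeasureTheory in
lemma Af_aesm (q : ℝ) (m : ℕ) : AEStronglyMeasurable (Af q m) volume :=
  (fm_continuous q m).aestronglyMeasurable.indicator measurableSet_Ioc

lemma Af_norm_le {q : ℝ} (hq0 : 0 < q) (hq1 : q < 1) {m : ℕ} (hm : 0 < m) (t : ℝ) :
    ‖Af q m t‖ ≤ Real.exp (-(2 * (q * (1-q)) / Real.pi^2) * t^2) := by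
  unfold Af
  by_cases h : t ∈ Set.Ioc (-(Real.pi * √m)) (Real.pi * √m)
  · rw [Set.indicator_of_mem h, neg_mul]
    exact fm_norm_le hq0 hq1 hm (abs_le.mpr ⟨h.1.le, h.2⟩)
  · rw [Set.indicator_of_notMem h]; simp; positivity

lemma phi_scaled (q : ℝ) (k : ℕ) {m : ℕ} (hm : 0 < m) :
    ((2 * Real.pi * √m * phi q k m : ℝ) : ℂ) =
      ∫ t : ℝ, Af q m t * Complex.exp (-(Complex.I * ((k - m * q) / √m : ℝ) * t)) := by
  have hpos : 0 < √(m:ℝ) := by positivity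
  have h2 : (√(m:ℝ) : ℂ) * √(m:ℝ) = m := by
    rw [← Complex.ofReal_mul, Real.mul_self_sqrt (by positivity)]; simp
  have h0 : (√(m:ℝ) : ℂ) ≠ 0 := by exact_mod_cast hpos.ne'
  have e1 : ∀ t : ℝ, Af q m t * Complex.exp (-(Complex.I * ((k - m * q) / √m : ℝ) * t)) =
      (Set.Ioc (-(Real.pi * √m)) (Real.pi * √m)).indicator (fun t : ℝ =>
       (fun θ : ℝ => chi q θ ^ m * Complex.exp (-(k * θ * Complex.I))) (t / √m)) t := by
    intro t
    unfold Af
    by_cases h : t ∈ Set.Ioc (-(Real.pi * √m)) (Real.pi * √m)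
    · rw [Set.indicator_of_mem h, Set.indicator_of_mem h]
      unfold fm
      rw [mul_right_comm, ← Complex.exp_add, mul_comm]
      congr 2
      push_cast
      field_simp
      rw [pow_two, h2]
      ring
    · rw [Set.indicator_of_notMem h, Set.indicator_of_notMem h, zero_mul]
  simp_rw [e1]
  rw [MeasureTheory.integral_indicator measurableSet_Ioc,
    ← intervalIntegral.integral_of_le (by have := Real.pi_pos; nlinarith [mul_pos this hpos]),
    intervalIntegral.integral_comp_div
      (fun θ : ℝ => chi q θ ^ m * Complex.exp (-(k * θ * Complex.I))) hpos.ne', neg_div, mul_div_cancel_right₀ _ hpos.ne',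
    ← phi_fourier, Complex.real_smul]
  push_cast; ring

noncomputable def Em (q : ℝ) (m : ℕ) : ℝ :=
  ∫ t : ℝ, ‖Af q m t - Complex.exp (-((q * (1-q) / 2 : ℝ) : ℂ) * t ^ 2)‖

lemma gnorm (a t : ℝ) : ‖Complex.exp (-(a : ℂ) * t ^ 2)‖ = Real.exp (-a * t^2) := by
  rw [← Complex.ofReal_neg, ← Complex.ofReal_pow, ← Complex.ofReal_mul, Complex.norm_exp_ofReal]

open MeasureTheory in
lemma Af_integrable {q : ℝ} (hq0 : 0 < q) (hq1 : q < 1) {m : ℕ} (hm : 0 < m) :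
    Integrable (Af q m) := by
  have hv : 0 < q * (1-q) := mul_pos hq0 (by linarith)
  refine (integrable_exp_neg_mul_sq (b := 2 * (q * (1-q)) / Real.pi^2) (by positivity)).mono'
    (Af_aesm q m) (ae_of_all _ fun t => Af_norm_le hq0 hq1 hm t)

open MeasureTheory in
lemma gauss_integrable {a : ℝ} (ha : 0 < a) :
    Integrable (fun t : ℝ => Complex.exp (-(a : ℂ) * t ^ 2)) :=
  integrable_cexp_neg_mul_sq (by simpa using ha)

open MeasureTheory Filter Topology in
lemma Em_tendsto {q : ℝ} (hq0 : 0 < q) (hq1 : q < 1) : Tendsto (Em q) atTop (𝓝 0) := by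
  have hv : 0 < q * (1-q) := mul_pos hq0 (by linarith)
  have h0 : (0:ℝ) = ∫ t : ℝ, (0:ℝ) := by simp
  rw [h0]
  unfold Em
  refine tendsto_integral_filter_of_dominated_convergence
    (fun t => Real.exp (-(2 * (q * (1-q)) / Real.pi^2) * t^2) + Real.exp (-(q * (1-q) / 2) * t^2))
    ?_ ?_ ?_ ?_
  · refine Eventually.of_forall fun m => ?_
    exact ((Af_aesm q m).sub (gauss_integrable (by positivity)).aestronglyMeasurable).norm
  · filter_upwards [eventually_gt_atTop 0] with m hm
    refine ae_of_all _ fun t => ?_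
    rw [norm_norm]
    refine (norm_sub_le _ _).trans ?_
    rw [gnorm]
    gcongr
    exact Af_norm_le hq0 hq1 hm t
  · exact (integrable_exp_neg_mul_sq (by positivity)).add (integrable_exp_neg_mul_sq (by positivity))
  · refine ae_of_all _ fun t => ?_
    have h1 : Tendsto (fun m => Af q m t) atTop (𝓝 (Complex.exp (-((q * (1-q) / 2 : ℝ) : ℂ) * t ^ 2))) := by
      refine (fm_tendsto hq0 hq1 t).congr' ?_
      have h3 : Tendsto (fun m : ℕ => Real.pi * √(m:ℝ)) atTop atTop :=
        Tendsto.const_mul_atTop Real.pi_pos (Real.tendsto_sqrt_atTop.comp tendsto_natCast_atTop_atTop)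
      filter_upwards [h3.eventually_gt_atTop |t|] with m hm
      unfold Af
      have := abs_lt.mp hm
      have hmem : t ∈ Set.Ioc (-(Real.pi * √m)) (Real.pi * √m) := ⟨this.1, this.2.le⟩
      rw [Set.indicator_of_mem hmem]
    rw [tendsto_iff_norm_sub_tendsto_zero] at h1
    exact h1

lemma exp_norm_one (x t : ℝ) : ‖Complex.exp (-(Complex.I * x * t))‖ = 1 := by
  have := Complex.norm_exp_ofReal_mul_I (-(x*t))
  push_cast at this
  rw [← this]; ring_nf

open MeasureTheory in
lemma phi_bound {q : ℝ} (hq0 : 0 < q) (hq1 : q < 1) (k : ℕ) {m : ℕ} (hm : 0 < m) :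
    2 * Real.pi * √m * phi q k m ≤ ∫ t : ℝ, Real.exp (-(2 * (q * (1-q)) / Real.pi^2) * t^2) := by
  have hv : 0 < q * (1-q) := mul_pos hq0 (by linarith)
  have h := congrArg norm (phi_scaled q k hm)
  rw [Complex.norm_real] at h
  refine (le_abs_self _).trans (h.trans_le ?_)
  refine (norm_integral_le_integral_norm _).trans ?_
  refine integral_mono_of_nonneg (ae_of_all _ fun t => norm_nonneg _)
    (integrable_exp_neg_mul_sq (by positivity)) (ae_of_all _ fun t => ?_)
  simp only [norm_mul]
  rw [exp_norm_one, mul_one]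
  exact Af_norm_le hq0 hq1 hm t

lemma gauss_ft' {V : ℝ} (hV : 0 < V) (x : ℝ) :
    ∫ t : ℝ, Complex.exp (-((V/2:ℝ):ℂ) * t^2) * Complex.exp (-(Complex.I * x * t)) =
      ((√(2 * Real.pi / V) * Real.exp (-x^2 / (2*V)) : ℝ) : ℂ) := by
  have := gauss_ft hV (-x)
  rw [neg_sq] at this
  rw [← this]
  congr 1
  ext t
  rw [mul_comm]
  congr 2
  push_cast; ring

open MeasureTheory in
lemma phi_llt {q : ℝ} (hq0 : 0 < q) (hq1 : q < 1) (k : ℕ) {m : ℕ} (hm : 0 < m) :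
    |2 * Real.pi * √m * phi q k m -
      √(2 * Real.pi / (q*(1-q))) * Real.exp (-((k - m * q) / √m)^2 / (2*(q*(1-q))))| ≤ Em q m := by
  have hv : 0 < q * (1-q) := mul_pos hq0 (by linarith)
  rw [← Real.norm_eq_abs, ← Complex.norm_real, Complex.ofReal_sub, phi_scaled q k hm,
    ← gauss_ft' hv, ← integral_sub]
  · unfold Em
    refine (norm_integral_le_integral_norm _).trans (le_of_eq ?_)
    congr 1
    ext t
    rw [← sub_mul, norm_mul, exp_norm_one, mul_one]
  · refine (Af_integrable hq0 hq1 hm).mul_of_top_left ?_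
    exact memLp_top_of_bound (by fun_prop) 1 (ae_of_all _ fun t => (exp_norm_one _ t).le)
  · refine (gauss_integrable (by positivity)).mul_of_top_left ?_
    exact memLp_top_of_bound (by fun_prop) 1 (ae_of_all _ fun t => (exp_norm_one _ t).le)

open MeasureTheory Filter Topology in
lemma sum_gauss_tendsto {q : ℝ} (hq0 : 0 < q) (hq1 : q < 1) {V : ℝ} (hV : 0 < V) :
    Tendsto (fun m : ℕ => ∑ k ∈ range (m+1), phi q k m *
      (√(2 * Real.pi / V) * Real.exp (-((k - m * q) / √m)^2 / (2*V)))) atTop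
      (𝓝 (√(2 * Real.pi / (V + q*(1-q))))) := by
  have hv : 0 < q * (1-q) := mul_pos hq0 (by linarith)
  have h1 : ∀ᶠ m : ℕ in atTop, ∫ t : ℝ, fm q m t * Complex.exp (-((V/2:ℝ):ℂ) * t^2) =
    ((∑ k ∈ range (m+1), phi q k m *
      (√(2 * Real.pi / V) * Real.exp (-((k - m * q) / √m)^2 / (2*V))) : ℝ) : ℂ) := by
    filter_upwards [eventually_gt_atTop 0] with m hm
    simp_rw [fm_eq_sum q hm, Finset.sum_mul]
    rw [integral_finsetSum]
    · rw [Complex.ofReal_sum]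
      refine Finset.sum_congr rfl fun k _ => ?_
      simp_rw [mul_assoc (phi q k m : ℂ)]
      rw [integral_const_mul, gauss_ft hV]
      push_cast; rfl
    · intro k _
      simp_rw [mul_assoc (phi q k m : ℂ)]
      apply Integrable.const_mul
      refine (gauss_integrable (by positivity)).mul_of_top_right ?_
      refine memLp_top_of_bound (by fun_prop) 1 (ae_of_all _ fun t => ?_)
      have := exp_norm_one (-(((k:ℝ) - m * q) / √m)) t
      rw [← this]
      apply le_of_eq
      congr 2
      push_cast; ring
  have h2 : Tendsto (fun m : ℕ => ∫ t : ℝ, fm q m t * Complex.exp (-((V/2:ℝ):ℂ) * t^2)) atTop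
      (𝓝 (∫ t : ℝ, Complex.exp (-((q * (1-q) / 2 : ℝ) : ℂ) * t ^ 2) * Complex.exp (-((V/2:ℝ):ℂ) * t^2))) := by
    refine tendsto_integral_filter_of_dominated_convergence (fun t => Real.exp (-(V/2) * t^2))
      ?_ ?_ ?_ ?_
    · refine Eventually.of_forall fun m => ?_
      exact (fm_continuous q m).aestronglyMeasurable.mul
        (gauss_integrable (by positivity)).aestronglyMeasurable
    · filter_upwards [eventually_gt_atTop 0] with m hm
      refine ae_of_all _ fun t => ?_
      rw [norm_mul, gnorm]
      exact mul_le_of_le_one_left (Real.exp_pos _).le (fm_norm_le_one hq0 hq1 hm t)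
    · exact integrable_exp_neg_mul_sq (by positivity)
    · refine ae_of_all _ fun t => ?_
      exact (fm_tendsto hq0 hq1 t).mul_const _
  have h3 : ∫ t : ℝ, Complex.exp (-((q * (1-q) / 2 : ℝ) : ℂ) * t ^ 2) * Complex.exp (-((V/2:ℝ):ℂ) * t^2)
      = ((√(2 * Real.pi / (V + q*(1-q))) : ℝ) : ℂ) := by
    have := gauss_ft (V := V + q*(1-q)) (by positivity) 0
    simp only [Complex.ofReal_zero, mul_zero, zero_mul, Complex.exp_zero, one_mul] at this
    rw [show (-(0:ℝ)^2 / (2 * (V + q*(1-q)))) = 0 by simp, Real.exp_zero, mul_one] at this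
    rw [← this]
    congr 1
    ext t
    rw [← Complex.exp_add]
    congr 1
    push_cast; ring
  rw [h3] at h2
  have h4 := h2.congr' h1
  exact (Complex.continuous_re.tendsto _).comp h4

open Filter Topology in
/-- The main-term asymptotics. -/
lemma main_term {q : ℝ} (hq0 : 0 < q) (hq1 : q < 1) {r : ℕ} (hr : 0 < r) :
    Tendsto (fun m : ℕ => (∑ k ∈ range (m+1), phi q k m ^ (r+1)) * √((r:ℝ)+1) *
      √(2 * Real.pi * (q * (1-q)) * m) ^ r) atTop (𝓝 1) := by
  have hv : 0 < q * (1-q) := mul_pos hq0 (by linarith)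
  set v := q * (1-q) with hvdef
  set K : ℝ := ∫ t : ℝ, Real.exp (-(2 * v / Real.pi^2) * t^2) with hK
  set g : ℕ → ℕ → ℝ := fun m k => √(2 * Real.pi / v) * Real.exp (-((k - m * q) / √m)^2 / (2*v)) with hg
  set C : ℝ := max K (√(2 * Real.pi / v)) with hC
  have hgC : ∀ m k, |g m k| ≤ C := by
    intro m k
    rw [abs_of_nonneg (by positivity)]
    refine le_trans ?_ (le_max_right _ _)
    apply mul_le_of_le_one_right (by positivity)
    rw [Real.exp_le_one_iff]
    apply div_nonpos_of_nonpos_of_nonneg _ (by positivity)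
    have := sq_nonneg (((k:ℝ) - m * q) / √m)
    linarith
  have hrr : (0:ℝ) < r := by exact_mod_cast hr
  have hV : 0 < v / r := by positivity
  have h1 := sum_gauss_tendsto hq0 hq1 hV
  rw [← hvdef] at h1
  -- Σ phi * g^r tends
  set c0 : ℝ := √(2 * Real.pi / v) ^ r / √(2 * Real.pi / (v / r)) with hc0
  have h2 : Tendsto (fun m : ℕ => ∑ k ∈ range (m+1), phi q k m * g m k ^ r) atTop
      (𝓝 (c0 * √(2 * Real.pi / (v / r + v)))) := by
    refine (h1.const_mul c0).congr fun m => ?_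
    rw [Finset.mul_sum]
    refine Finset.sum_congr rfl fun k _ => ?_
    simp only [hg, hc0]
    rw [mul_pow, ← Real.exp_nat_mul]
    have : (r:ℝ) * (-((k - m * q) / √m)^2 / (2*v)) = -((k - m * q) / √m)^2 / (2*(v / r)) := by
      field_simp
    rw [this]
    have : √(2 * Real.pi / (v / r)) ≠ 0 := by positivity
    field_simp
  have hd : Tendsto (fun m : ℕ => ∑ k ∈ range (m+1), phi q k m * (2 * Real.pi * √m * phi q k m) ^ r -
      ∑ k ∈ range (m+1), phi q k m * g m k ^ r) atTop (𝓝 0) := by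
    have hE := (Em_tendsto hq0 hq1).mul_const (r * C ^ (r-1))
    rw [zero_mul] at hE
    refine squeeze_zero_norm' ?_ hE
    filter_upwards [eventually_gt_atTop 0] with m hm
    rw [← Finset.sum_sub_distrib]
    refine (norm_sum_le _ _).trans ?_
    have : Em q m * (r * C ^ (r-1)) = ∑ k ∈ range (m+1), phi q k m * (Em q m * (r * C ^ (r-1))) := by
      rw [← Finset.sum_mul, phi_sum_one, one_mul]
    rw [this]
    refine Finset.sum_le_sum fun k _ => ?_
    have hp := phi_nonneg' hq0 hq1 k m
    rw [← mul_sub, norm_mul, Real.norm_of_nonneg hp, Real.norm_eq_abs]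
    refine mul_le_mul_of_nonneg_left ?_ hp
    refine (abs_pow_sub_pow_le ..).trans ?_
    rw [mul_assoc]
    have hb1 := phi_llt hq0 hq1 k hm
    have hb2 : |2 * Real.pi * √m * phi q k m| ≤ C := by
      rw [abs_of_nonneg (by positivity)]
      exact (phi_bound hq0 hq1 k hm).trans (le_max_left _ _)
    have hm3 : max |2 * Real.pi * √m * phi q k m| |g m k| ≤ C := max_le hb2 (hgC m k)
    have hE0 : 0 ≤ Em q m := (abs_nonneg _).trans hb1
    gcongr
  have h3 := (hd.add h2).congr (fun m => sub_add_cancel _ _)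
  rw [zero_add] at h3
  have h4 := h3.const_mul (√((r:ℝ)+1) * (√(2 * Real.pi * v) / (2 * Real.pi)) ^ r)
  have e : √((r:ℝ)+1) * (√(2 * Real.pi * v) / (2 * Real.pi)) ^ r * (c0 * √(2 * Real.pi / (v / r + v))) = 1 := by
    have e1 : √(2 * Real.pi * v) / (2 * Real.pi) * √(2 * Real.pi / v) = 1 := by
      rw [div_mul_eq_mul_div, ← Real.sqrt_mul (by positivity)]
      rw [show 2 * Real.pi * v * (2 * Real.pi / v) = (2 * Real.pi)^2 by field_simp, Real.sqrt_sq (by positivity)]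
      field_simp
    have e2 : √((r:ℝ)+1) * √(2 * Real.pi / (v / r + v)) = √(2 * Real.pi / (v / r)) := by
      rw [← Real.sqrt_mul (by positivity)]
      congr 1; field_simp; ring
    have e3 : √(2 * Real.pi / (v / r)) ≠ 0 := by positivity
    calc _ = (√(2 * Real.pi * v) / (2 * Real.pi) * √(2 * Real.pi / v)) ^ r *
          (√((r:ℝ)+1) * √(2 * Real.pi / (v / r + v))) / √(2 * Real.pi / (v / r)) := by
            rw [hc0, mul_pow]; ring
      _ = 1 := by rw [e1, e2, one_pow, one_mul, div_self e3]
  rw [e] at h4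
  refine h4.congr fun m => ?_
  have : ∀ k, phi q k m * (2 * Real.pi * √m * phi q k m) ^ r = (2 * Real.pi)^r * √m ^ r * phi q k m ^ (r+1) := by
    intro k; ring
  simp_rw [this]
  rw [← Finset.mul_sum, Real.sqrt_mul (by positivity) (m:ℝ), div_pow, mul_pow]
  field_simp
  ring

open Finset

noncomputable def bw (q : ℝ) (b : Bool) : ℝ := if b then q else 1 - q

noncomputable def wt (q : ℝ) {ι : Type} [Fintype ι] (c : ι → Bool) : ℝ := ∏ i, bw q (c i)

noncomputable def Nt {ι : Type} [Fintype ι] (c : ι → Bool) : ℕ := #{i | c i = true}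

lemma wt_eq (q : ℝ) {ι : Type} [Fintype ι] (c : ι → Bool) :
    wt q c = q ^ Nt c * (1-q) ^ (Fintype.card ι - Nt c) := by
  classical
  unfold wt bw Nt
  rw [Finset.prod_ite, Finset.prod_const, Finset.prod_const]
  congr 2
  rw [Finset.filter_not, Finset.card_sdiff_of_subset (Finset.filter_subset _ _), Finset.card_univ]

lemma bernWeight_eq (q : ℝ) (n : ℕ) (c : Fin n → Bool) : bernWeight q n c = wt q c := by
  rw [wt_eq]; simp [bernWeight, Nt]

lemma wt_nonneg {q : ℝ} (hq0 : 0 < q) (hq1 : q < 1) {ι : Type} [Fintype ι] (c : ι → Bool) :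
    0 ≤ wt q c := by
  rw [wt_eq]
  have : 0 < 1 - q := by linarith
  positivity

lemma sum_wt_Nt (q : ℝ) {ι : Type} [Fintype ι] [DecidableEq ι] (k : ℕ) :
    ∑ c : ι → Bool with Nt c = k, wt q c = phi q k (Fintype.card ι) := by
  have h1 : ∀ c ∈ ({c : ι → Bool | Nt c = k} : Finset _), wt q c = q ^ k * (1-q) ^ (Fintype.card ι - k) := by
    intro c hc
    rw [wt_eq, (Finset.mem_filter.mp hc).2]
  rw [Finset.sum_congr rfl h1, Finset.sum_const, nsmul_eq_mul, phi, mul_assoc]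
  congr 2
  rw [← Finset.card_univ, ← Finset.card_powersetCard]
  refine Finset.card_bij' (fun c _ => ({i | c i = true} : Finset ι)) (fun s _ i => decide (i ∈ s)) ?_ ?_ ?_ ?_
  · intro c hc
    simp only [Finset.mem_filter, Finset.mem_univ, true_and] at hc
    simp only [Finset.mem_powersetCard, Finset.subset_univ, true_and]
    exact hc
  · intro s hs
    simp only [Finset.mem_powersetCard, Finset.subset_univ, true_and] at hs
    rw [Finset.mem_filter]
    refine ⟨Finset.mem_univ _, ?_⟩
    unfold Nt
    simpa using hs
  · intro c _; ext i; simp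
  · intro s _; ext i; simp

lemma Nt_le {ι : Type} [Fintype ι] (c : ι → Bool) : Nt c ≤ Fintype.card ι := by
  unfold Nt; exact Finset.card_le_univ _

/-- class sums -/
noncomputable def Scl (m d : ℕ) (c : Fin (m*d) → Bool) (a : Fin d) : ℕ :=
  Nt (fun b : Fin m => c (finProdFinEquiv (b, a)))

open Classical in
lemma pushforward (q : ℝ) (m d : ℕ) (F : (Fin d → ℕ) → Prop) :
    ∑ c : Fin (m*d) → Bool, (if F (Scl m d c) then wt q c else 0) =
      ∑ s ∈ Fintype.piFinset (fun _ : Fin d => range (m+1)),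
        if F s then ∏ a, phi q (s a) m else 0 := by
  -- reindex
  let e : (Fin (m*d) → Bool) ≃ (Fin d → Fin m → Bool) :=
    ((finProdFinEquiv (m := m) (n := d)).symm.arrowCongr (Equiv.refl Bool)).trans
      (((Equiv.prodComm (Fin m) (Fin d)).arrowCongr (Equiv.refl Bool)).trans (Equiv.curry _ _ _))
  have he : ∀ c a b, e c a b = c (finProdFinEquiv (b, a)) := by
    intro c a b; rfl
  have hw : ∀ c, wt q c = ∏ a, wt q (e c a) := by
    intro c
    unfold wt
    rw [← Equiv.prod_comp (finProdFinEquiv (m := m) (n := d)), Fintype.prod_prod_type_right]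
    rfl
  have hS : ∀ c, Scl m d c = fun a => Nt (e c a) := fun c => rfl
  simp_rw [hw, hS]
  rw [Equiv.sum_comp e (fun y => if F (fun a => Nt (y a)) then ∏ a, wt q (y a) else 0)]
  rw [← Finset.sum_fiberwise_of_maps_to (s := Finset.univ)
    (t := Fintype.piFinset (fun _ : Fin d => range (m+1)))
    (g := fun (y : Fin d → Fin m → Bool) a => Nt (y a))]
  · refine Finset.sum_congr rfl fun s hs => ?_
    have h1 : ∀ y ∈ ({y | (fun a => Nt (y a)) = s} : Finset (Fin d → Fin m → Bool)),
      (if F (fun a => Nt (y a)) then ∏ a, wt q (y a) else 0) = if F s then ∏ a, wt q (y a) else 0 := by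
      intro y hy
      rw [(Finset.mem_filter.mp hy).2]
    rw [Finset.sum_congr rfl h1]
    split_ifs with hF
    · have h2 : ∀ a : Fin d, phi q (s a) m = ∑ c : Fin m → Bool with Nt c = s a, wt q c := by
        intro a; rw [sum_wt_Nt]; simp
      simp_rw [h2]
      rw [Finset.prod_univ_sum]
      refine Finset.sum_congr ?_ fun _ _ => rfl
      ext y
      simp [Fintype.mem_piFinset, funext_iff]
    · simp
  · intro y _
    simp only [Fintype.mem_piFinset, Finset.mem_range]
    intro a
    have := Nt_le (y a)
    simp at this
    omega

lemma phi_nonneg2 {q : ℝ} (hq0 : 0 < q) (hq1 : q < 1) (k m : ℕ) : 0 ≤ phi q k m := by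
  unfold phi
  have : 0 < 1 - q := by linarith
  positivity

lemma phi_sum_one2 (q : ℝ) (m : ℕ) : ∑ k ∈ range (m+1), phi q k m = 1 := by
  have := add_pow q (1 - q) m
  rw [add_sub_cancel, one_pow] at this
  rw [this]
  refine Finset.sum_congr rfl fun k _ => ?_
  unfold phi; ring

open Classical in
lemma anti {q : ℝ} (hq0 : 0 < q) (hq1 : q < 1) (m d : ℕ) (F : (Fin d → ℕ) → Prop) (T : Finset (Fin d))
    (hF : ∀ s s', F s → F s' → (∀ a, a ∉ T → s a = s' a) → s = s')
    (M : ℝ) (hM : ∀ k, phi q k m ≤ M) :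
    ∑ s ∈ Fintype.piFinset (fun _ : Fin d => range (m+1)),
        (if F s then ∏ a, phi q (s a) m else 0) ≤ M ^ #T := by
  have hM0 : 0 ≤ M := (phi_nonneg2 hq0 hq1 0 m).trans (hM 0)
  rw [← Finset.sum_filter]
  set P := Fintype.piFinset (fun _ : Fin d => range (m+1)) with hP
  have h1 : ∀ s ∈ P.filter F, ∏ a, phi q (s a) m ≤ M ^ #T * ∏ a : {a // a ∉ T}, phi q (s a) m := by
    intro s _
    rw [← Finset.prod_mul_prod_compl T]
    have e1 : ∏ a ∈ Tᶜ, phi q (s a) m = ∏ a : {a // a ∉ T}, phi q (s a) m := by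
      rw [Finset.prod_subtype (p := fun a => a ∉ T)]
      intro x; simp
    rw [e1]
    refine mul_le_mul_of_nonneg_right ?_ (Finset.prod_nonneg fun a _ => phi_nonneg2 hq0 hq1 _ _)
    rw [← Finset.prod_const]
    exact Finset.prod_le_prod (fun a _ => phi_nonneg2 hq0 hq1 _ _) (fun a _ => hM _)
  refine (Finset.sum_le_sum h1).trans ?_
  rw [← Finset.mul_sum]
  refine mul_le_of_le_one_right (by positivity) ?_
  let r : (Fin d → ℕ) → ({a // a ∉ T} → ℕ) := fun s a => s a
  have hinj : Set.InjOn r (P.filter F) := by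
    intro s hs s' hs' h
    refine hF s s' (Finset.mem_filter.mp hs).2 (Finset.mem_filter.mp hs').2 fun a ha => ?_
    exact congrFun h ⟨a, ha⟩
  have h2 : ∑ s ∈ P.filter F, ∏ a : {a // a ∉ T}, phi q (s a) m =
      ∑ u ∈ (P.filter F).image r, ∏ a, phi q (u a) m := by
    rw [Finset.sum_image hinj]
  rw [h2]
  have h3 : (P.filter F).image r ⊆ Fintype.piFinset (fun _ : {a // a ∉ T} => range (m+1)) := by
    intro u hu
    obtain ⟨s, hs, rfl⟩ := Finset.mem_image.mp hu
    rw [Fintype.mem_piFinset]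
    intro a
    exact Fintype.mem_piFinset.mp (Finset.mem_filter.mp hs).1 a
  refine (Finset.sum_le_sum_of_subset_of_nonneg h3
    (fun u _ _ => Finset.prod_nonneg fun a _ => phi_nonneg2 hq0 hq1 _ _)).trans ?_
  rw [← Finset.prod_univ_sum (fun _ => range (m+1)) (fun _ k => phi q k m)]
  simp [phi_sum_one2]

lemma root_indep {d : ℕ} (hd : 0 < d) {ω : ℂ} (hω : IsPrimitiveRoot ω d) (u : Fin d → ℤ)
    (h0 : ∑ a, (u a : ℂ) * ω ^ (a:ℕ) = 0) (hu : ∀ a : Fin d, d.totient ≤ a → u a = 0) : u = 0 := by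
  classical
  let P : Polynomial ℚ := ∑ a : Fin d, Polynomial.C (u a : ℚ) * Polynomial.X ^ (a:ℕ)
  have hc : ∀ k, P.coeff k = if h : k < d then (u ⟨k, h⟩ : ℚ) else 0 := by
    intro k
    simp only [P, Polynomial.finsetSum_coeff, Polynomial.coeff_C_mul, Polynomial.coeff_X_pow]
    split_ifs with h
    · rw [Finset.sum_eq_single ⟨k, h⟩]
      · simp
      · intro b _ hb
        have : k ≠ b := fun e => hb (Fin.ext e.symm)
        simp [this]
      · simp
    · apply Finset.sum_eq_zero
      intro b _
      have : k ≠ b := by have := b.2; omega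
      simp [this]
  have hP0 : P = 0 := by
    by_contra hne
    have hdeg : P.degree < d.totient := by
      rw [Polynomial.degree_lt_iff_coeff_zero]
      intro k hk
      rw [hc]
      split_ifs with h
      · rw [hu ⟨k, h⟩ hk]; simp
      · rfl
    have hev : Polynomial.aeval ω P = 0 := by
      simp only [P, map_sum, map_mul, Polynomial.aeval_C, map_pow, Polynomial.aeval_X]
      simpa using h0
    have h1 := minpoly.degree_le_of_ne_zero ℚ ω hne hev
    rw [← Polynomial.cyclotomic_eq_minpoly_rat hω hd, Polynomial.degree_cyclotomic] at h1
    exact absurd (lt_of_le_of_lt h1 hdeg) (lt_irrefl _)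
  funext a
  have := hc a
  rw [hP0] at this
  simpa using this.symm

lemma root_conj {d n : ℕ} (hd : 0 < d) {ω ω' : ℂ} (hω : IsPrimitiveRoot ω d) (hω' : IsPrimitiveRoot ω' d)
    (c : Fin n → Bool) (h : ∑ j, (if c j then (1:ℂ) else 0) * ω ^ (j:ℕ) = 0) :
    ∑ j, (if c j then (1:ℂ) else 0) * ω' ^ (j:ℕ) = 0 := by
  let P : Polynomial ℚ := ∑ a : Fin n, Polynomial.C (if c a then (1:ℚ) else 0) * Polynomial.X ^ (a:ℕ)
  have hev : ∀ z : ℂ, Polynomial.aeval z P = ∑ j, (if c j then (1:ℂ) else 0) * z ^ (j:ℕ) := by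
    intro z
    simp only [P, map_sum, map_mul, Polynomial.aeval_C, map_pow, Polynomial.aeval_X]
    refine Finset.sum_congr rfl fun j _ => ?_
    split_ifs <;> simp
  rw [← hev] at h ⊢
  have h1 := minpoly.dvd ℚ ω h
  rw [← Polynomial.cyclotomic_eq_minpoly_rat hω hd, Polynomial.cyclotomic_eq_minpoly_rat hω' hd] at h1
  obtain ⟨Q, hQ⟩ := h1
  rw [hQ, map_mul, minpoly.aeval, zero_mul]

lemma det_zero_iff {n : ℕ} (hn : 0 < n) {ζ : ℂ} (hζ : IsPrimitiveRoot ζ n) (c : Fin n → Bool) :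
    (Matrix.of fun i j : Fin n => (if c (j - i) then (1 : ℚ) else 0)).det = 0 ↔
      ∃ k : Fin n, ∑ j, (if c j then (1:ℂ) else 0) * (ζ ^ (k:ℕ)) ^ (j:ℕ) = 0 := by
  have : NeZero n := ⟨hn.ne'⟩
  set A : Matrix (Fin n) (Fin n) ℚ := Matrix.of fun i j : Fin n => (if c (j - i) then (1 : ℚ) else 0) with hA
  set B : Matrix (Fin n) (Fin n) ℂ := Matrix.of fun i j : Fin n => (if c (j - i) then (1 : ℂ) else 0) with hB
  have hAB : ((A.det : ℚ) : ℂ) = B.det := by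
    have := RingHom.map_det (algebraMap ℚ ℂ) A
    simp only [eq_ratCast] at this
    rw [this]
    congr 1
    ext i j
    simp [hA, hB, apply_ite]
  set V := (Matrix.vandermonde (fun k : Fin n => ζ ^ (k:ℕ))).transpose with hV
  have hVdet : V.det ≠ 0 := by
    rw [hV, Matrix.det_transpose, Matrix.det_vandermonde_ne_zero_iff]
    intro i j hij
    exact Fin.ext (hζ.pow_inj i.2 j.2 hij)
  set D : Fin n → ℂ := fun k => ∑ j, (if c j then (1:ℂ) else 0) * (ζ ^ (k:ℕ)) ^ (j:ℕ) with hD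
  have hmul : B * V = V * Matrix.diagonal D := by
    ext i k
    rw [Matrix.mul_apply, Matrix.mul_diagonal]
    simp only [hB, hV, hD, Matrix.transpose_apply, Matrix.vandermonde_apply, Matrix.of_apply]
    rw [← Equiv.sum_comp (Equiv.addRight i), Finset.mul_sum]
    refine Finset.sum_congr rfl fun l _ => ?_
    simp only [Equiv.coe_addRight, add_sub_cancel_right]
    have hw : (ζ ^ (k:ℕ)) ^ n = 1 := by rw [← pow_mul, mul_comm, pow_mul, hζ.pow_eq_one, one_pow]
    rw [Fin.val_add, ← pow_eq_pow_mod _ hw, pow_add]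
    ring
  have hdet : B.det = ∏ k, D k := by
    have := congrArg Matrix.det hmul
    rw [Matrix.det_mul, Matrix.det_mul, Matrix.det_diagonal, mul_comm] at this
    exact mul_left_cancel₀ hVdet this
  have : A.det = 0 ↔ B.det = 0 := by rw [← hAB]; simp
  rw [this, hdet, Finset.prod_eq_zero_iff]
  simp only [Finset.mem_univ, true_and, hD]

noncomputable def om (d : ℕ) : ℂ := Complex.exp (2 * Real.pi * Complex.I / d)

lemma om_prim {d : ℕ} (hd : 0 < d) : IsPrimitiveRoot (om d) d := Complex.isPrimitiveRoot_exp d hd.ne'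

open Classical in
noncomputable def Qd (q : ℝ) (d n : ℕ) : ℝ :=
  ∑ c : Fin n → Bool, if ∑ j, (if c j then (1:ℂ) else 0) * om d ^ (j:ℕ) = 0 then wt q c else 0

lemma Pq_lower {q : ℝ} (hq0 : 0 < q) (hq1 : q < 1) {n p : ℕ} (hn : 0 < n) (hp : p ∣ n) :
    Qd q p n ≤ Pq q n := by
  classical
  unfold Qd Pq
  refine Finset.sum_le_sum fun c _ => ?_
  rw [bernWeight_eq]
  have hp0 := Nat.pos_of_dvd_of_pos hp hn
  have h0 := wt_nonneg hq0 hq1 c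
  by_cases h : ∑ j, (if c j then (1:ℂ) else 0) * om p ^ (j:ℕ) = 0
  · have hdet := (det_zero_iff hn (om_prim hn) c).mpr (by
      have hpn : (om p) ^ n = 1 := by
        obtain ⟨e, rfl⟩ := hp
        rw [pow_mul, (om_prim hp0).pow_eq_one, one_pow]
      have : NeZero n := ⟨hn.ne'⟩
      obtain ⟨k, hk, hk'⟩ := (om_prim hn).eq_pow_of_pow_eq_one hpn
      refine ⟨⟨k, hk⟩, ?_⟩
      simpa only [hk'] using h)
    rw [if_pos h, if_pos hdet]
  · rw [if_neg h]
    split_ifs <;> simp [h0]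

lemma Pq_upper {q : ℝ} (hq0 : 0 < q) (hq1 : q < 1) {n : ℕ} (hn : 0 < n) :
    Pq q n ≤ ∑ d ∈ n.divisors, Qd q d n := by
  classical
  unfold Qd Pq
  rw [Finset.sum_comm]
  refine Finset.sum_le_sum fun c _ => ?_
  rw [bernWeight_eq]
  have h0 := wt_nonneg hq0 hq1 c
  have hnn : ∀ d ∈ n.divisors, 0 ≤ if ∑ j, (if c j then (1:ℂ) else 0) * om d ^ (j:ℕ) = 0 then wt q c else 0 := by
    intro d _; split_ifs <;> simp [h0]
  split_ifs with h
  · obtain ⟨k, hk⟩ := (det_zero_iff hn (om_prim hn) c).mp h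
    set ω := om n ^ (k:ℕ) with hω
    have h1 : ω ^ n = 1 := by rw [hω, ← pow_mul, mul_comm, pow_mul, (om_prim hn).pow_eq_one, one_pow]
    have hd : orderOf ω ∣ n := orderOf_dvd_of_pow_eq_one h1
    have hd0 := Nat.pos_of_dvd_of_pos hd hn
    have h2 := root_conj hd0 (IsPrimitiveRoot.orderOf ω) (om_prim hd0) c hk
    have h3 := Finset.single_le_sum hnn (Nat.mem_divisors.mpr ⟨hd, hn.ne'⟩)
    rw [if_pos h2] at h3
    exact h3
  · exact Finset.sum_nonneg hnn

lemma class_sum (m d : ℕ) {ω : ℂ} (hω : ω ^ d = 1) (c : Fin (m*d) → Bool) :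
    ∑ j, (if c j then (1:ℂ) else 0) * ω ^ (j:ℕ) = ∑ a : Fin d, (Scl m d c a : ℂ) * ω ^ (a:ℕ) := by
  rw [← Equiv.sum_comp (finProdFinEquiv (m := m) (n := d)), Fintype.sum_prod_type_right]
  refine Finset.sum_congr rfl fun a _ => ?_
  unfold Scl Nt
  rw [Finset.card_filter]
  push_cast
  rw [Finset.sum_mul]
  refine Finset.sum_congr rfl fun b _ => ?_
  rw [finProdFinEquiv_apply_val, pow_add, pow_mul, hω, one_pow, mul_one]

lemma Qd_push (q : ℝ) (m : ℕ) {d : ℕ} (hd : 0 < d) [DecidablePred fun s : Fin d → ℕ => ∑ a : Fin d, (s a : ℂ) * om d ^ (a:ℕ) = 0] :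
    Qd q d (m*d) = ∑ s ∈ Fintype.piFinset (fun _ : Fin d => range (m+1)),
        if ∑ a : Fin d, (s a : ℂ) * om d ^ (a:ℕ) = 0 then ∏ a, phi q (s a) m else 0 := by
  classical
  unfold Qd
  simp_rw [class_sum m d (om_prim hd).pow_eq_one]
  convert! pushforward q m d (fun s => ∑ a : Fin d, (s a : ℂ) * om d ^ (a:ℕ) = 0) using 3

lemma Qd_le {q : ℝ} (hq0 : 0 < q) (hq1 : q < 1) (m : ℕ) {d : ℕ} (hd : 0 < d) (M : ℝ)
    (hM : ∀ k, phi q k m ≤ M) : Qd q d (m*d) ≤ M ^ d.totient := by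
  classical
  rw [Qd_push q m hd]
  have hT : #({a : Fin d | (a:ℕ) < d.totient} : Finset (Fin d)) = d.totient := by
    rw [Fin.card_filter_val_lt]
    exact min_eq_right d.totient_le
  conv_rhs => rw [← hT]
  refine anti hq0 hq1 m d (fun s => ∑ a : Fin d, (s a : ℂ) * om d ^ (a:ℕ) = 0) _ ?_ M hM
  intro s s' hs hs' h
  have := root_indep hd (om_prim hd) (fun a => (s a : ℤ) - s' a) (by
    push_cast
    simp_rw [sub_mul]
    rw [Finset.sum_sub_distrib, hs, hs', sub_zero]) (by
    intro a ha
    have := h a (by simpa using ha)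
    omega)
  funext a
  have := congrFun this a
  simp only [Pi.zero_apply] at this
  omega

lemma Qd_prime (q : ℝ) (m : ℕ) {p : ℕ} (hp : p.Prime) :
    Qd q p (m*p) = ∑ k ∈ range (m+1), phi q k m ^ p := by
  classical
  have hp0 := hp.pos
  have : NeZero p := ⟨hp0.ne'⟩
  rw [Qd_push q m hp0, ← Finset.sum_filter]
  have hgeom : ∑ a : Fin p, om p ^ (a:ℕ) = 0 := by
    rw [Fin.sum_univ_eq_sum_range (fun i => om p ^ i)]
    exact (om_prim hp0).geom_sum_eq_zero hp.one_lt
  symm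
  refine Finset.sum_bij' (fun k _ => fun _ => k) (fun s _ => s 0) ?_ ?_ ?_ ?_ ?_
  · intro k hk
    rw [Finset.mem_filter, Fintype.mem_piFinset]
    refine ⟨fun _ => hk, ?_⟩
    rw [← Finset.mul_sum, hgeom, mul_zero]
  · intro s hs
    exact Fintype.mem_piFinset.mp (Finset.mem_filter.mp hs).1 0
  · intro k _; rfl
  · intro s hs
    have h0 := (Finset.mem_filter.mp hs).2
    let l : Fin p := ⟨p-1, by omega⟩
    have := root_indep hp0 (om_prim hp0) (fun a => (s a : ℤ) - s l) (by
      push_cast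
      simp_rw [sub_mul]
      rw [Finset.sum_sub_distrib, h0, ← Finset.mul_sum, hgeom, mul_zero, sub_zero]) (by
      intro a ha
      rw [Nat.totient_prime hp] at ha
      have : a = l := Fin.ext (by have := a.2; simp only [l]; omega)
      rw [this]; simp)
    funext a
    have h1 := congrFun this a
    have h2 := congrFun this 0
    simp only [Pi.zero_apply] at h1 h2
    omega
  · intro k _; simp

lemma Qd_one (q : ℝ) (n : ℕ) : Qd q 1 n = (1-q)^n := by
  classical
  unfold Qd
  have h1 : om 1 = 1 := by simpa using (om_prim one_pos).pow_eq_one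
  rw [Finset.sum_eq_single (fun _ => false)]
  · simp [wt, bw]
  · intro c _ hc
    rw [if_neg]
    intro h
    apply hc
    simp only [h1, one_pow, mul_one] at h
    have h2 : ((∑ j, if c j then 1 else 0 : ℕ) : ℂ) = 0 := by push_cast; exact h
    rw [Nat.cast_eq_zero, Finset.sum_eq_zero_iff] at h2
    funext j
    have := h2 j (Finset.mem_univ _)
    by_contra hcon
    simp at hcon
    simp [hcon] at this
  · simp

open Finset

lemma phi_succ (q : ℝ) (m k : ℕ) :
    phi q (k+1) (m+1) = q * phi q k m + (1-q) * phi q (k+1) m := by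
  unfold phi
  rw [Nat.choose_succ_succ]
  push_cast
  by_cases h : k + 1 ≤ m
  · rw [show m - k = m - (k+1) + 1 by omega]
    ring
  · rw [Nat.choose_eq_zero_of_lt (show m < k+1 by omega)]
    push_cast
    ring

lemma phi_pair_le_one {q : ℝ} (hq0 : 0 < q) (hq1 : q < 1) (m k : ℕ) :
    phi q k m + phi q (k+1) m ≤ 1 := by
  have hz : ∀ j, m < j → phi q j m = 0 := fun j hj => by simp [phi, Nat.choose_eq_zero_of_lt hj]
  have h2 : ∑ j ∈ range (m+1+k+2), phi q j m = 1 := by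
    rw [← phi_sum_one q m]
    symm
    apply Finset.sum_subset
    · intro x; simp only [Finset.mem_range]; omega
    · intro x _ hx; exact hz x (by simpa using hx)
  rw [← h2]
  have h3 : phi q k m + phi q (k+1) m = ∑ j ∈ {k, k+1}, phi q j m := by
    rw [Finset.sum_pair (by omega)]
  rw [h3]
  apply Finset.sum_le_sum_of_subset_of_nonneg
  · intro x; simp only [Finset.mem_insert, Finset.mem_singleton, Finset.mem_range]; omega
  · intro j _ _; exact phi_nonneg' hq0 hq1 j m

lemma phi_le_rho {q : ℝ} (hq0 : 0 < q) (hq1 : q < 1) {m : ℕ} (hm : 0 < m) (k : ℕ) :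
    phi q k m ≤ max q (1-q) := by
  obtain ⟨m, rfl⟩ : ∃ l, m = l + 1 := ⟨m-1, by omega⟩
  cases k with
  | zero =>
    refine le_trans ?_ (le_max_right _ _)
    simp only [phi, Nat.choose_zero_right, Nat.cast_one, pow_zero, mul_one, one_mul, Nat.sub_zero]
    exact pow_le_of_le_one (by linarith) (by linarith) (by omega)
  | succ k =>
    rw [phi_succ]
    have h1 := phi_pair_le_one hq0 hq1 m k
    have h2 := phi_nonneg' hq0 hq1 k m
    have h3 := phi_nonneg' hq0 hq1 (k+1) m
    have h4 := le_max_left q (1-q)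
    have h5 := le_max_right q (1-q)
    have h6 : 0 < max q (1-q) := lt_of_lt_of_le hq0 h4
    nlinarith [mul_le_mul_of_nonneg_right h4 h2, mul_le_mul_of_nonneg_right h5 h3]

lemma totient_aux (d : ℕ) (hd : 0 < d) : d ≤ d.totient ^ 2 * Nat.gcd 2 d := by
  induction d using Nat.recOnPosPrimePosCoprime with
  | zero => omega
  | one => simp
  | prime_pow p k hp hk =>
    rw [Nat.totient_prime_pow hp hk]
    obtain ⟨k, rfl⟩ : ∃ l, k = l + 1 := ⟨k-1, by omega⟩
    simp only [Nat.add_sub_cancel]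
    have h1 : 1 ≤ p ^ k := Nat.one_le_pow _ _ hp.pos
    rcases hp.eq_two_or_odd' with rfl | hodd
    · have : Nat.gcd 2 (2^(k+1)) = 2 := Nat.gcd_eq_left (Dvd.intro_left _ rfl)
      rw [this, pow_succ]
      nlinarith
    · have h3 : 3 ≤ p := by
        have := hp.two_le
        rcases hodd with ⟨j, rfl⟩; omega
      have hg : 1 ≤ Nat.gcd 2 (p^(k+1)) := Nat.gcd_pos_of_pos_left _ (by norm_num)
      obtain ⟨r, rfl⟩ : ∃ r, p = r + 1 := ⟨p-1, by omega⟩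
      simp only [Nat.add_sub_cancel]
      calc (r+1)^(k+1) = (r+1)^k * (r+1) := pow_succ _ _
        _ ≤ ((r+1)^k)^2 * r^2 := by
          apply Nat.mul_le_mul
          · nlinarith
          · nlinarith
        _ = ((r+1)^k * r)^2 * 1 := by ring
        _ ≤ _ := Nat.mul_le_mul_left _ hg
  | coprime a b ha hb hab iha ihb =>
    rw [Nat.totient_mul hab, Nat.Coprime.gcd_mul _ hab]
    calc a * b ≤ _ := Nat.mul_le_mul (iha (by omega)) (ihb (by omega))
      _ = _ := by ring

lemma totient_lower {d : ℕ} (hd : 0 < d) : d ≤ 2 * d.totient ^ 2 := by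
  have := totient_aux d hd
  have h2 : Nat.gcd 2 d ≤ 2 := Nat.gcd_le_left _ (by norm_num)
  nlinarith [Nat.mul_le_mul_left (d.totient^2) h2]

lemma totient_ge {n p d : ℕ} (hp : p.Prime) (hn : n.minFac = p) (hd : d ∣ n) (h1 : d ≠ 1)
    (hdp : d ≠ p) (hn0 : 0 < n) : p ≤ d.totient := by
  have hd0 := Nat.pos_of_dvd_of_pos hd hn0
  have hpd : p ≤ d.minFac := by
    rw [← hn]; exact Nat.minFac_le_of_dvd (Nat.minFac_prime h1).two_le ((Nat.minFac_dvd d).trans hd)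
  have hlt : p < d := lt_of_le_of_ne (hpd.trans (Nat.minFac_le hd0)) (Ne.symm hdp)
  rw [Nat.totient_eq_card_coprime]
  have hsub : insert (d-1) (Finset.Ico 1 p) ⊆ ({a ∈ range d | d.Coprime a} : Finset ℕ) := by
    intro x hx
    rw [Finset.mem_insert, Finset.mem_Ico] at hx
    rw [Finset.mem_filter, Finset.mem_range]
    rcases hx with rfl | ⟨hx1, hx2⟩
    · refine ⟨by omega, ?_⟩
      have h := Nat.coprime_self_add_right (m := d-1) (n := 1)
      have h2 : (d-1).Coprime ((d-1)+1) := by simp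
      rw [Nat.sub_add_cancel hd0] at h2
      exact h2.symm
    · refine ⟨by omega, ?_⟩
      by_contra hcon
      obtain ⟨r, hr, hr1, hr2⟩ := Nat.Prime.not_coprime_iff_dvd.mp hcon
      have h3 : d.minFac ≤ r := Nat.minFac_le_of_dvd hr.two_le hr1
      have h4 := Nat.le_of_dvd (by omega) hr2
      omega
  have hc := Finset.card_le_card hsub
  rw [Finset.card_insert_of_notMem (by rw [Finset.mem_Ico]; omega), Nat.card_Ico] at hc
  have := hp.two_le
  omega

/-- error terms -/
lemma error_bound {q : ℝ} (hq0 : 0 < q) (hq1 : q < 1) {p : ℕ} (hp : p.Prime) (δ : ℝ)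
    {C : ℝ} (hC0 : 0 ≤ C) (hC : ∀ m k : ℕ, 0 < m → √m * phi q k m ≤ C) {n : ℕ} (hn : n.minFac = p)
    (hn0 : 0 < n) (hM : C * (n:ℝ) ^ ((δ-1)/2) ≤ 1) :
    ∑ d ∈ (n.divisors).erase p, Qd q d n ≤ (1-q)^n + n * (max q (1-q)) ^ ((n:ℝ)^(δ/2)/2)
      + (n:ℝ)^δ * (C * (n:ℝ) ^ ((δ-1)/2)) ^ p := by
  have hnR : (0:ℝ) < n := by exact_mod_cast hn0
  set ρ := max q (1-q) with hρ
  have hρ0 : 0 < ρ := lt_of_lt_of_le hq0 (le_max_left _ _)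
  have hρ1 : ρ < 1 := max_lt hq1 (by linarith)
  set M := C * (n:ℝ) ^ ((δ-1)/2) with hMdef
  have hM0 : 0 ≤ M := by positivity
  set T := ((n.divisors).erase p).erase 1 with hT
  have h1mem : 1 ∈ (n.divisors).erase p := by
    rw [Finset.mem_erase]; exact ⟨hp.one_lt.ne, by simp [hn0.ne']⟩
  rw [← Finset.add_sum_erase _ _ h1mem, Qd_one, add_assoc]
  gcongr
  have key : ∀ d ∈ T, Qd q d n ≤ ρ ^ ((n:ℝ)^(δ/2)/2) + if (d:ℝ) ≤ (n:ℝ)^δ then M ^ p else 0 := by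
    intro d hd
    simp only [hT, Finset.mem_erase, Nat.mem_divisors] at hd
    obtain ⟨hd1, hdp, hdn, _⟩ := hd
    have hd0 := Nat.pos_of_dvd_of_pos hdn hn0
    obtain ⟨m, rfl⟩ := hdn
    have hm0 : 0 < m := Nat.pos_of_mul_pos_left hn0
    have htot := totient_ge hp hn (Dvd.intro _ rfl) hd1 hdp hn0
    have hcomm : d * m = m * d := mul_comm _ _
    split_ifs with hle
    · have hb : ∀ k, phi q k m ≤ M := by
        intro k
        have h1 := hC m k hm0
        have hsm : 0 < √(m:ℝ) := by positivity
        have h2 : phi q k m ≤ C / √m := by rw [le_div_iff₀ hsm, mul_comm]; exact h1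
        refine h2.trans ?_
        rw [hMdef, div_eq_mul_inv]
        gcongr
        rw [inv_le_comm₀ hsm (by positivity), ← Real.rpow_neg hnR.le]
        apply Real.le_sqrt_of_sq_le
        rw [← Real.rpow_natCast, ← Real.rpow_mul hnR.le]
        have : (-((δ-1)/2)) * ((2:ℕ):ℝ) = 1 - δ := by push_cast; ring
        rw [this, Real.rpow_sub hnR, Real.rpow_one, div_le_iff₀ (by positivity)]
        have hmR : (0:ℝ) < m := by exact_mod_cast hm0
        calc ((d * m : ℕ) : ℝ) = m * d := by push_cast; ring
          _ ≤ _ := by gcongr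
      have h3 := Qd_le hq0 hq1 m hd0 M hb
      rw [← hcomm] at h3
      have h4 : M ^ d.totient ≤ M ^ p := pow_le_pow_of_le_one hM0 hM htot
      have h5 : 0 ≤ ρ ^ (((d*m:ℕ):ℝ)^(δ/2)/2) := by positivity
      linarith
    · rw [add_zero]
      have h3 := Qd_le hq0 hq1 m hd0 ρ (phi_le_rho hq0 hq1 hm0)
      rw [← hcomm] at h3
      refine h3.trans ?_
      rw [← Real.rpow_natCast]
      apply Real.rpow_le_rpow_of_exponent_ge hρ0 hρ1.le
      push Not at hle
      have h4 : (d:ℝ) ≤ 2 * (d.totient:ℝ)^2 := by exact_mod_cast totient_lower hd0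
      have h5 : (((d*m:ℕ):ℝ)^(δ/2))^2 = ((d*m:ℕ):ℝ)^δ := by
        rw [← Real.rpow_natCast, ← Real.rpow_mul hnR.le]; congr 1; push_cast; ring
      have h6 : (((d*m:ℕ):ℝ)^(δ/2))^2 ≤ (2 * (d.totient:ℝ))^2 := by
        rw [h5]; nlinarith
      have h7 := abs_le_of_sq_le_sq h6 (by positivity)
      linarith [(abs_le.mp h7).2]
  refine (Finset.sum_le_sum key).trans ?_
  rw [Finset.sum_add_distrib, Finset.sum_const, nsmul_eq_mul, ← Finset.sum_filter, Finset.sum_const,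
    nsmul_eq_mul]
  have hTn : T ⊆ Finset.Icc 1 n := by
    intro d hd
    simp only [hT, Finset.mem_erase, Nat.mem_divisors] at hd
    rw [Finset.mem_Icc]
    exact ⟨Nat.pos_of_dvd_of_pos hd.2.2.1 hn0, Nat.le_of_dvd hn0 hd.2.2.1⟩
  gcongr
  · have := Finset.card_le_card hTn
    simpa using this
  · have h8 : T.filter (fun d : ℕ => (d:ℝ) ≤ (n:ℝ)^δ) ⊆ Finset.Icc 1 ⌊(n:ℝ)^δ⌋₊ := by
      intro d hd
      rw [Finset.mem_filter] at hd
      rw [Finset.mem_Icc]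
      exact ⟨(Finset.mem_Icc.mp (hTn hd.1)).1, Nat.le_floor hd.2⟩
    have := Finset.card_le_card h8
    rw [Nat.card_Icc, Nat.add_sub_cancel] at this
    calc _ ≤ ((⌊(n:ℝ)^δ⌋₊ : ℕ) : ℝ) := by exact_mod_cast this
      _ ≤ _ := Nat.floor_le (by positivity)

open Filter Topology

lemma exp_decay {ρ : ℝ} (h0 : 0 < ρ) (h1 : ρ < 1) (s : ℝ) :
    Tendsto (fun x : ℝ => x ^ s * ρ ^ x) atTop (𝓝 0) := by
  have := tendsto_rpow_mul_exp_neg_mul_atTop_nhds_zero s (-Real.log ρ) (by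
    have := Real.log_neg h0 h1; linarith)
  refine this.congr fun x => ?_
  rw [Real.rpow_def_of_pos h0, neg_neg]

lemma error_tendsto {q : ℝ} (hq0 : 0 < q) (hq1 : q < 1) {p : ℕ} (a C δ : ℝ) (ha : a = ((p:ℝ)-1)/2)
    (hδ0 : 0 < δ) (hδ : δ * (p + 2) < 1) :
    Tendsto (fun n : ℕ => (n:ℝ)^a * ((1-q)^n + n * (max q (1-q)) ^ ((n:ℝ)^(δ/2)/2)
      + (n:ℝ)^δ * (C * (n:ℝ) ^ ((δ-1)/2)) ^ p)) atTop (𝓝 0) := by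
  set ρ := max q (1-q) with hρ
  have hρ0 : 0 < ρ := lt_of_lt_of_le hq0 (le_max_left _ _)
  have hρ1 : ρ < 1 := max_lt hq1 (by linarith)
  have t1 : Tendsto (fun n : ℕ => (n:ℝ)^a * (1-q)^n) atTop (𝓝 0) := by
    have := (exp_decay (ρ := 1-q) (by linarith) (by linarith) a).comp (tendsto_natCast_atTop_atTop (R := ℝ))
    refine this.congr fun n => ?_
    simp
  have t2 : Tendsto (fun n : ℕ => (n:ℝ)^a * (n * ρ ^ ((n:ℝ)^(δ/2)/2))) atTop (𝓝 0) := by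
    have hx : Tendsto (fun n : ℕ => (n:ℝ)^(δ/2)/2) atTop atTop :=
      ((tendsto_rpow_atTop (by positivity)).comp tendsto_natCast_atTop_atTop).atTop_div_const (by norm_num)
    have h := ((exp_decay hρ0 hρ1 ((a+1) * (2/δ))).comp hx).const_mul ((2:ℝ)^((a+1) * (2/δ)))
    rw [mul_zero] at h
    refine h.congr' ?_
    filter_upwards [eventually_gt_atTop 0] with n hn
    have hnR : (0:ℝ) < n := by exact_mod_cast hn
    simp only [Function.comp]
    rw [← mul_assoc, ← mul_assoc, ← Real.mul_rpow (by norm_num) (by positivity)]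
    congr 1
    rw [mul_div_cancel₀ _ (by norm_num : (2:ℝ) ≠ 0), ← Real.rpow_mul hnR.le]
    rw [show δ/2 * ((a+1) * (2/δ)) = a + 1 by field_simp, Real.rpow_add hnR, Real.rpow_one]
  have t3 : Tendsto (fun n : ℕ => (n:ℝ)^a * ((n:ℝ)^δ * (C * (n:ℝ) ^ ((δ-1)/2)) ^ p)) atTop (𝓝 0) := by
    have h := ((tendsto_rpow_neg_atTop (y := (1 - δ * (p+2))/2) (by linarith)).comp
      (tendsto_natCast_atTop_atTop (R := ℝ))).const_mul (C^p)
    rw [mul_zero] at h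
    refine h.congr' ?_
    filter_upwards [eventually_gt_atTop 0] with n hn
    have hnR : (0:ℝ) < n := by exact_mod_cast hn
    simp only [Function.comp]
    rw [mul_pow, ← Real.rpow_natCast ((n:ℝ) ^ ((δ-1)/2)), ← Real.rpow_mul hnR.le]
    rw [show (n:ℝ)^a * ((n:ℝ)^δ * (C^p * (n:ℝ)^((δ-1)/2*p))) = C^p * ((n:ℝ)^a * (n:ℝ)^δ * (n:ℝ)^((δ-1)/2*p)) by ring,
      ← Real.rpow_add hnR, ← Real.rpow_add hnR]
    congr 2
    rw [ha]; ring
  have := (t1.add t2).add t3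
  simp only [add_zero] at this
  refine this.congr fun n => ?_
  ring

theorem Pq_asymptotic_fixed_smallest_prime (p : ℕ) (hp : p.Prime) (q : ℝ)
    (hq0 : 0 < q) (hq1 : q < 1) :
    ∀ ε > (0 : ℝ), ∃ N : ℕ, ∀ n : ℕ, n > N → ¬ n.Prime → n.minFac = p →
      |Pq q n * Real.sqrt p *
          (2 * Real.pi * q * (1 - q) / p) ^ (((p : ℝ) - 1) / 2) *
          (n : ℝ) ^ (((p : ℝ) - 1) / 2) - 1| < ε := by
  intro ε hε
  have hpR : (0:ℝ) < p := by exact_mod_cast hp.pos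
  have h1q : 0 < 1 - q := by linarith
  obtain ⟨r, rfl⟩ : ∃ r, p = r + 1 := ⟨p-1, by have := hp.pos; omega⟩
  have hr : 0 < r := by have := hp.two_le; omega
  set a : ℝ := (((r+1:ℕ):ℝ) - 1)/2 with ha
  have har : a = r / 2 := by rw [ha]; push_cast; ring
  -- constant
  obtain ⟨C, hC0, hC⟩ : ∃ C : ℝ, 0 ≤ C ∧ ∀ m k : ℕ, 0 < m → √m * phi q k m ≤ C := by
    refine ⟨(∫ t : ℝ, Real.exp (-(2 * (q * (1-q)) / Real.pi^2) * t^2)) / (2 * Real.pi), ?_, ?_⟩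
    · exact div_nonneg (MeasureTheory.integral_nonneg fun t => (Real.exp_pos _).le) (by positivity)
    · intro m k hm
      rw [le_div_iff₀ (by positivity)]
      have := phi_bound hq0 hq1 k hm
      linarith
  set δ : ℝ := 1 / ((r+1:ℕ) + 3) with hδ
  have hδ0 : 0 < δ := by positivity
  have hδ1 : δ * ((r+1:ℕ) + 2) < 1 := by
    rw [hδ, one_div, inv_mul_lt_iff₀ (by positivity)]; linarith
  have hδ2 : δ < 1 := by
    have : (0:ℝ) ≤ (r+1:ℕ) := by positivity
    nlinarith
  set K : ℝ := √((r+1:ℕ):ℝ) * (2 * Real.pi * q * (1 - q) / (r+1:ℕ)) ^ a with hK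
  have hK0 : 0 ≤ K := by positivity
  have hmain := main_term hq0 hq1 hr
  have herr := (error_tendsto hq0 hq1 (p := r+1) a C δ ha hδ0 hδ1).const_mul K
  rw [mul_zero] at herr
  have hMt : Tendsto (fun n : ℕ => C * (n:ℝ) ^ ((δ-1)/2)) atTop (𝓝 0) := by
    have h := ((tendsto_rpow_neg_atTop (y := (1 - δ)/2) (by linarith)).comp
      (tendsto_natCast_atTop_atTop (R := ℝ))).const_mul C
    rw [mul_zero] at h
    refine h.congr fun n => ?_
    simp only [Function.comp]
    congr 2; ring
  obtain ⟨N1, hN1⟩ := (Metric.tendsto_atTop.mp hmain) (ε/2) (by positivity)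
  obtain ⟨N2, hN2⟩ := (Metric.tendsto_atTop.mp herr) (ε/2) (by positivity)
  obtain ⟨N3, hN3⟩ := (Metric.tendsto_atTop.mp hMt) 1 (by positivity)
  refine ⟨N1 * (r+1) + N2 + N3, fun n hn _ hmin => ?_⟩
  have hn0 : 0 < n := by omega
  have hdvd : (r+1) ∣ n := hmin ▸ Nat.minFac_dvd n
  have hlow := Pq_lower hq0 hq1 hn0 hdvd
  have hup := Pq_upper hq0 hq1 hn0
  rw [← Finset.add_sum_erase _ _ (Nat.mem_divisors.mpr ⟨hdvd, hn0.ne'⟩)] at hup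
  have hM1 : C * (n:ℝ) ^ ((δ-1)/2) ≤ 1 := by
    have := hN3 n (by omega)
    rw [Real.dist_eq, sub_zero] at this
    exact (le_abs_self _).trans this.le
  have hE := error_bound hq0 hq1 hp δ hC0 hC hmin hn0 hM1
  have hN2' := hN2 n (by omega)
  rw [Real.dist_eq, sub_zero] at hN2'
  have hN2'' := (le_abs_self _).trans_lt hN2'
  set R := (1-q)^n + n * (max q (1-q)) ^ ((n:ℝ)^(δ/2)/2)
      + (n:ℝ)^δ * (C * (n:ℝ) ^ ((δ-1)/2)) ^ (r+1) with hR
  obtain ⟨m, rfl⟩ : ∃ m, n = m * (r+1) := by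
    obtain ⟨m, rfl⟩ := hdvd; exact ⟨m, mul_comm _ _⟩
  have hm : N1 ≤ m := by
    by_contra hcon
    push Not at hcon
    have := Nat.mul_le_mul_right (r+1) hcon.le
    omega
  have hm0 : 0 < m := Nat.pos_of_mul_pos_right hn0
  have hmR : (0:ℝ) < m := by exact_mod_cast hm0
  have hN1' := hN1 m hm
  rw [Real.dist_eq] at hN1'
  have hQ := Qd_prime q m hp
  rw [← hQ] at hN1'
  set Q := Qd q (r+1) (m*(r+1))
  set X : ℝ := ((m*(r+1) : ℕ) : ℝ) ^ a with hX
  have hX0 : 0 ≤ X := by positivity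
  have hconv : √((r:ℝ)+1) * √(2 * Real.pi * (q * (1-q)) * m) ^ r = K * X := by
    rw [hK, hX, mul_assoc (√((r+1:ℕ):ℝ)), ← Real.mul_rpow (by positivity) (by positivity)]
    congr 1
    · push_cast; rfl
    · rw [Real.sqrt_eq_rpow, ← Real.rpow_natCast, ← Real.rpow_mul (by positivity), har]
      congr 1
      · push_cast; field_simp
      · ring
  rw [mul_assoc Q, hconv] at hN1'
  have hgoal : Pq q (m*(r+1)) * √((r+1:ℕ):ℝ) * (2 * Real.pi * q * (1 - q) / (r+1:ℕ)) ^ a * X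
    = Pq q (m*(r+1)) * (K * X) := by rw [hK]; ring
  rw [hgoal]
  have hKX : 0 ≤ K * X := by positivity
  have h1 : Pq q (m*(r+1)) * (K*X) ≤ Q * (K*X) + K * (X * R) := by
    have : Pq q (m*(r+1)) ≤ Q + R := by linarith
    calc _ ≤ (Q + R) * (K*X) := mul_le_mul_of_nonneg_right this hKX
      _ = _ := by ring
  have h2 : Q * (K*X) ≤ Pq q (m*(r+1)) * (K*X) := mul_le_mul_of_nonneg_right hlow hKX
  rw [abs_lt] at hN1' ⊢
  constructor <;> linarith [hN1'.1, hN1'.2]
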